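/- Let F be a finite field with q elements, let m ≥ 1, let w be a noncommutative polynomial in m variables over F, and for d ≥ 1, A ∈ M_d(F)^m write T_d(A) for the trace of the evaluation of w at A. Set N_d(λ) = #{A ∈ M_d(F)^m : T_d(A) = λ}, let X_{d,d,λ} be the set of pairs (v,A) ∈ F^d × M_d(F)^m with T_d(A) = λ and with the smallest subspace of F^d containing v and invariant under A_1,…,A_m equal to all of F^d, and set B_d(λ) = #X_{d,d,λ} / #GL_d(F) as a rational number. Fix n ≥ 1 and assume that for every 1 ≤ d ≤ n and all nonzero λ, λ' ∈ F one has N_d(λ) = N_d(λ') and #X_{d,d,λ} = #X_{d,d,λ'}. Then, as rational numbers, (q^n − 1)·(N_n(0) − N_n(1))/#GL_n(F) = (B_n(0) − B_n(1)) + Σ_{k=1}^{n−1} q^{(m−1)k(n−k)} · (B_k(0) − B_k(1)) · (N_{n−k}(0) − N_{n−k}(1)) / #GL_{n−k}(F). (Here 1 denotes the multiplicative unit of F, assumed distinct from 0.) -/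

import Mathlib

open Matrix

/-- Trace of the evaluation of a noncommutative polynomial at a tuple of matrices. -/
noncomputable def trEval (F : Type) [Field F] (m d : ℕ) (w : FreeAlgebra F (Fin m))
    (A : Fin m → Matrix (Fin d) (Fin d) F) : F :=
  Matrix.trace (FreeAlgebra.lift F A w)

/-- The smallest subspace of `F^d` containing `v` and invariant under `A_1, …, A_m`. -/
def genSubspace (F : Type) [Field F] (m d : ℕ) (v : Fin d → F)
    (A : Fin m → Matrix (Fin d) (Fin d) F) : Submodule F (Fin d → F) :=
  Submodule.span F {x | ∃ l : List (Fin m), x = (l.map A).prod.mulVec v}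

/-- `N_d(λ) = #{A ∈ M_d(F)^m : Tr(w(A)) = λ}`. -/
noncomputable def Ncount (F : Type) [Field F] (m : ℕ) (w : FreeAlgebra F (Fin m))
    (d : ℕ) (lam : F) : ℕ :=
  Nat.card {A : Fin m → Matrix (Fin d) (Fin d) F // trEval F m d w A = lam}

/-- `#X_{d,d,λ}`: pairs `(v,A)` with `Tr(w(A)) = λ` and `v` a cyclic vector for `A`. -/
noncomputable def Xcount (F : Type) [Field F] (m : ℕ) (w : FreeAlgebra F (Fin m))
    (d : ℕ) (lam : F) : ℕ :=
  Nat.card {p : (Fin d → F) × (Fin m → Matrix (Fin d) (Fin d) F) //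
    trEval F m d w p.2 = lam ∧ genSubspace F m d p.1 p.2 = ⊤}

/-- `B_d(λ) = #X_{d,d,λ} / #GL_d(F)` as a rational number. -/
noncomputable def Bcount (F : Type) [Field F] (m : ℕ) (w : FreeAlgebra F (Fin m))
    (d : ℕ) (lam : F) : ℚ :=
  (Xcount F m w d lam : ℚ) / (Nat.card (GL (Fin d) F) : ℚ)

/-- Inclusion of the first block of coordinates. -/
def inlCoord (F ι κ : Type) [Field F] : (ι → F) →ₗ[F] (ι ⊕ κ → F) where
  toFun x := Sum.elim x 0
  map_add' x y := by ext (i | i) <;> simp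
  map_smul' c x := by ext (i | i) <;> simp

theorem inlCoord_injective {F ι κ : Type} [Field F] : Function.Injective (inlCoord F ι κ) := by
  intro x y h
  funext i
  exact congrFun h (Sum.inl i)

theorem mem_range_inlCoord {F ι κ : Type} [Field F] {x : ι ⊕ κ → F} :
    x ∈ LinearMap.range (inlCoord F ι κ) ↔ ∀ j, x (Sum.inr j) = 0 := by
  constructor
  · rintro ⟨y, rfl⟩ j
    rfl
  · intro h
    refine ⟨fun i => x (Sum.inl i), ?_⟩
    ext (i | i)
    · rfl
    · exact (h i).symm

section
variable {F : Type} [Field F] {m : ℕ} {ι κ : Type} [Fintype ι] [DecidableEq ι]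
  [Fintype κ] [DecidableEq κ]

/-- Subspace generated by a vector under a tuple of matrices with arbitrary finite index type. -/
def cyclicSubspace (v : ι → F) (A : Fin m → Matrix ι ι F) : Submodule F (ι → F) :=
  Submodule.span F {x | ∃ l : List (Fin m), x = (l.map A).prod.mulVec v}

theorem mem_cyclicSubspace_self (v : ι → F) (A : Fin m → Matrix ι ι F) :
    v ∈ cyclicSubspace v A :=
  Submodule.subset_span ⟨[], by simp⟩

theorem mulVec_mem_cyclicSubspace (v : ι → F) (A : Fin m → Matrix ι ι F) (i : Fin m)
    {x : ι → F} (hx : x ∈ cyclicSubspace v A) : A i *ᵥ x ∈ cyclicSubspace v A := by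
  have h : cyclicSubspace v A ≤ (cyclicSubspace v A).comap (A i).mulVecLin := by
    refine Submodule.span_le.2 ?_
    rintro _ ⟨l, rfl⟩
    exact Submodule.subset_span ⟨i :: l, by simp⟩
  exact h hx

theorem cyclicSubspace_map {A : Fin m → Matrix ι ι F} {B : Fin m → Matrix κ κ F}
    (J : (ι → F) →ₗ[F] (κ → F)) (hJ : ∀ i x, J (A i *ᵥ x) = B i *ᵥ J x) (v : ι → F) :
    cyclicSubspace (J v) B = (cyclicSubspace v A).map J := by
  have key : ∀ l : List (Fin m), (l.map B).prod *ᵥ J v = J ((l.map A).prod *ᵥ v) := by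
    intro l
    induction l with
    | nil => simp
    | cons i l ih => simp [← Matrix.mulVec_mulVec, ih, hJ]
  rw [cyclicSubspace, cyclicSubspace, Submodule.map_span]
  congr 1
  ext x
  constructor
  · rintro ⟨l, rfl⟩
    exact ⟨_, ⟨l, rfl⟩, (key l).symm⟩
  · rintro ⟨_, ⟨l, rfl⟩, rfl⟩
    exact ⟨l, (key l).symm⟩

theorem cyclicSubspace_eq_bot_iff (v : ι → F) (A : Fin m → Matrix ι ι F) :
    cyclicSubspace v A = ⊥ ↔ v = 0 := by
  constructor
  · intro h
    simpa [h] using mem_cyclicSubspace_self v A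
  · rintro rfl
    refine (Submodule.span_eq_bot).2 ?_
    rintro _ ⟨l, rfl⟩
    simp

/-- Conjugation of matrices by a linear equivalence. -/
noncomputable def matrixConj (f : (ι → F) ≃ₗ[F] (κ → F)) : Matrix ι ι F ≃ₐ[F] Matrix κ κ F :=
  (Matrix.toLinAlgEquiv'.trans (f.conjAlgEquiv F)).trans LinearMap.toMatrixAlgEquiv'

theorem matrixConj_mulVec (f : (ι → F) ≃ₗ[F] (κ → F)) (M : Matrix ι ι F) (x : ι → F) :
    matrixConj f M *ᵥ f x = f (M *ᵥ x) := by
  simp [matrixConj, ← Matrix.toLinAlgEquiv'_apply]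

theorem trace_matrixConj (f : (ι → F) ≃ₗ[F] (κ → F)) (M : Matrix ι ι F) :
    trace (matrixConj f M) = trace M := by
  have h := LinearMap.trace_conj' (Matrix.toLin' M) f
  rw [LinearMap.trace_eq_matrix_trace F (Pi.basisFun F κ),
    LinearMap.trace_eq_matrix_trace F (Pi.basisFun F ι)] at h
  simp only [LinearMap.toMatrix_eq_toMatrix', LinearMap.toMatrix'_toLin'] at h
  exact h

/-- Transport of a vector and a tuple of matrices along a linear equivalence. -/
noncomputable def transport (f : (ι → F) ≃ₗ[F] (κ → F))
    (p : (ι → F) × (Fin m → Matrix ι ι F)) : (κ → F) × (Fin m → Matrix κ κ F) :=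
  (f p.1, fun i => matrixConj f (p.2 i))

theorem transport_transport {μ : Type} [Fintype μ] [DecidableEq μ] (f : (ι → F) ≃ₗ[F] (κ → F))
    (g : (κ → F) ≃ₗ[F] (μ → F)) (p : (ι → F) × (Fin m → Matrix ι ι F)) :
    transport g (transport f p) = transport (f.trans g) p := by
  simp only [transport, matrixConj]
  refine Prod.ext rfl ?_
  funext i
  simp
  rfl

theorem transport_refl (p : (ι → F) × (Fin m → Matrix ι ι F)) :
    transport (LinearEquiv.refl F (ι → F)) p = p := by
  refine Prod.ext rfl ?_
  funext i
  exact LinearMap.toMatrixAlgEquiv'_toLinAlgEquiv' (p.2 i)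

theorem cyclicSubspace_transport (f : (ι → F) ≃ₗ[F] (κ → F))
    (p : (ι → F) × (Fin m → Matrix ι ι F)) :
    cyclicSubspace (transport f p).1 (transport f p).2 =
      (cyclicSubspace p.1 p.2).map (f : (ι → F) →ₗ[F] (κ → F)) :=
  cyclicSubspace_map (f : (ι → F) →ₗ[F] (κ → F))
    (fun i x => (matrixConj_mulVec f (p.2 i) x).symm) p.1

theorem trace_lift_transport (w : FreeAlgebra F (Fin m)) (f : (ι → F) ≃ₗ[F] (κ → F))
    (p : (ι → F) × (Fin m → Matrix ι ι F)) :
    trace (FreeAlgebra.lift F (transport f p).2 w) = trace (FreeAlgebra.lift F p.2 w) := by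
  have : FreeAlgebra.lift F (transport f p).2 =
      (matrixConj f : _ →ₐ[F] _).comp (FreeAlgebra.lift F p.2) := by
    ext1
    funext i
    simp [transport]
  rw [this]
  exact trace_matrixConj f _

theorem map_range_inlCoord_le_iff (M : Matrix (ι ⊕ κ) (ι ⊕ κ) F) :
    (∀ x ∈ LinearMap.range (inlCoord F ι κ), M *ᵥ x ∈ LinearMap.range (inlCoord F ι κ)) ↔
      M.toBlocks₂₁ = 0 := by
  constructor
  · intro h
    ext j i
    have := mem_range_inlCoord.1 (h _ (LinearMap.mem_range_self _ (Pi.single i 1))) j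
    rw [show inlCoord F ι κ (Pi.single i 1) = Pi.single (Sum.inl i) 1 by
      ext (a | a) <;> simp [inlCoord, Pi.single_apply], Matrix.mulVec_single_one] at this
    exact this
  · rintro h _ ⟨x, rfl⟩
    refine mem_range_inlCoord.2 fun j => ?_
    rw [← Matrix.fromBlocks_toBlocks M, h]
    simp [inlCoord, Matrix.fromBlocks_mulVec]

theorem cyclicSubspace_eq_range_inlCoord_iff (v : ι ⊕ κ → F)
    (A : Fin m → Matrix (ι ⊕ κ) (ι ⊕ κ) F) :
    cyclicSubspace v A = LinearMap.range (inlCoord F ι κ) ↔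
      (∀ j, v (Sum.inr j) = 0) ∧ (∀ i, (A i).toBlocks₂₁ = 0) ∧
        cyclicSubspace (fun i => v (Sum.inl i)) (fun i => (A i).toBlocks₁₁) = ⊤ := by
  have key : (∀ j, v (Sum.inr j) = 0) → (∀ i, (A i).toBlocks₂₁ = 0) →
      cyclicSubspace v A = (cyclicSubspace (fun i => v (Sum.inl i))
        (fun i => (A i).toBlocks₁₁)).map (inlCoord F ι κ) := by
    intro hv hA
    rw [← cyclicSubspace_map (B := A)]
    · congr 1
      ext (i | i)
      · rfl
      · exact hv i
    · intro i x
      conv_rhs => rw [← Matrix.fromBlocks_toBlocks (A i), hA i]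
      ext (j | j) <;> simp [inlCoord, Matrix.fromBlocks_mulVec]
  constructor
  · intro h
    have hv : ∀ j, v (Sum.inr j) = 0 :=
      mem_range_inlCoord.1 (h ▸ mem_cyclicSubspace_self v A)
    have hA : ∀ i, (A i).toBlocks₂₁ = 0 := fun i =>
      (map_range_inlCoord_le_iff (A i)).1 fun x hx =>
        h ▸ mulVec_mem_cyclicSubspace v A i (h.symm ▸ hx)
    refine ⟨hv, hA, ?_⟩
    rw [key hv hA, ← Submodule.map_top] at h
    exact Submodule.map_injective_of_injective inlCoord_injective h
  · rintro ⟨hv, hA, h⟩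
    rw [key hv hA, h, Submodule.map_top]

theorem trace_lift_of_toBlocks_zero (w : FreeAlgebra F (Fin m))
    {A : Fin m → Matrix (ι ⊕ κ) (ι ⊕ κ) F} (hA : ∀ i, (A i).toBlocks₂₁ = 0) :
    trace (FreeAlgebra.lift F A w) =
      trace (FreeAlgebra.lift F (fun i => (A i).toBlocks₁₁) w) +
        trace (FreeAlgebra.lift F (fun i => (A i).toBlocks₂₂) w) := by
  have : ∃ B, FreeAlgebra.lift F A w =
      fromBlocks (FreeAlgebra.lift F (fun i => (A i).toBlocks₁₁) w) B 0
        (FreeAlgebra.lift F (fun i => (A i).toBlocks₂₂) w) := by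
    induction w using FreeAlgebra.induction with
    | grade0 r =>
      refine ⟨0, ?_⟩
      simp only [AlgHom.commutes, Algebra.algebraMap_eq_smul_one (A := Matrix _ _ F)]
      rw [← Matrix.fromBlocks_one, Matrix.fromBlocks_smul]
      simp
    | grade1 i =>
      refine ⟨(A i).toBlocks₁₂, ?_⟩
      simp only [FreeAlgebra.lift_ι_apply]
      rw [← hA i, Matrix.fromBlocks_toBlocks]
    | mul a b ha hb =>
      obtain ⟨X, hX⟩ := ha
      obtain ⟨Y, hY⟩ := hb
      rw [map_mul, hX, hY, Matrix.fromBlocks_multiply]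
      simp
    | add a b ha hb =>
      obtain ⟨X, hX⟩ := ha
      obtain ⟨Y, hY⟩ := hb
      rw [map_add, hX, hY, Matrix.fromBlocks_add]
      simp
  obtain ⟨B, hB⟩ := this
  rw [hB]
  simp [Matrix.trace]


theorem card_subtype_isUnit (M : Type) [Monoid M] : Nat.card {x : M // IsUnit x} = Nat.card Mˣ := by
  refine (Nat.card_eq_of_bijective
    (fun u : Mˣ => (⟨u, u.isUnit⟩ : {x : M // IsUnit x})) ⟨?_, ?_⟩).symm
  · intro u v h
    exact Units.ext (congrArg Subtype.val h)
  · rintro ⟨_, u, rfl⟩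
    exact ⟨u, rfl⟩

/-- Automorphisms preserving the first block of coordinates, as block triangular matrices. -/
theorem card_stabilizer_range_inlCoord [Finite F] :
    Nat.card {f : (ι ⊕ κ → F) ≃ₗ[F] (ι ⊕ κ → F) //
        (LinearMap.range (inlCoord F ι κ)).map (f : (ι ⊕ κ → F) →ₗ[F] (ι ⊕ κ → F)) =
          LinearMap.range (inlCoord F ι κ)} =
      Nat.card (GL ι F) * Nat.card (GL κ F) * Nat.card F ^ (Fintype.card ι * Fintype.card κ) := by
  have e1 : Nat.card {f : (ι ⊕ κ → F) ≃ₗ[F] (ι ⊕ κ → F) //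
        (LinearMap.range (inlCoord F ι κ)).map (f : (ι ⊕ κ → F) →ₗ[F] (ι ⊕ κ → F)) =
          LinearMap.range (inlCoord F ι κ)} =
      Nat.card {g : GL (ι ⊕ κ) F // (g : Matrix (ι ⊕ κ) (ι ⊕ κ) F).toBlocks₂₁ = 0} := by
    refine (Nat.card_congr (Equiv.subtypeEquiv (Matrix.GeneralLinearGroup.toLin.trans
      (LinearMap.GeneralLinearGroup.generalLinearEquiv F (ι ⊕ κ → F))).toEquiv fun g => ?_)).symm
    rw [← map_range_inlCoord_le_iff]
    constructor
    · intro h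
      refine Submodule.eq_of_le_of_finrank_eq ?_ (LinearEquiv.finrank_map_eq _ _)
      rintro _ ⟨x, hx, rfl⟩
      exact h x hx
    · intro h x hx
      rw [← h]
      exact ⟨x, hx, rfl⟩
  have e2 : Nat.card {g : GL (ι ⊕ κ) F // (g : Matrix (ι ⊕ κ) (ι ⊕ κ) F).toBlocks₂₁ = 0} =
      Nat.card (({A : Matrix ι ι F // IsUnit A} × {D : Matrix κ κ F // IsUnit D}) ×
        Matrix ι κ F) := by
    have key : ∀ g : GL (ι ⊕ κ) F, (g : Matrix (ι ⊕ κ) (ι ⊕ κ) F).toBlocks₂₁ = 0 →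
        IsUnit (g : Matrix (ι ⊕ κ) (ι ⊕ κ) F).toBlocks₁₁ ∧
          IsUnit (g : Matrix (ι ⊕ κ) (ι ⊕ κ) F).toBlocks₂₂ := by
      intro g hg
      have h := g.isUnit
      rw [← Matrix.fromBlocks_toBlocks (g : Matrix (ι ⊕ κ) (ι ⊕ κ) F), hg,
        Matrix.isUnit_fromBlocks_zero₂₁] at h
      exact h
    refine Nat.card_eq_of_bijective (fun g => ((⟨_, (key g.1 g.2).1⟩, ⟨_, (key g.1 g.2).2⟩),
      (g.1 : Matrix (ι ⊕ κ) (ι ⊕ κ) F).toBlocks₁₂)) ⟨?_, ?_⟩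
    · rintro ⟨g, hg⟩ ⟨h, hh⟩ hgh
      simp only [Prod.mk.injEq, Subtype.mk.injEq] at hgh
      refine Subtype.ext (Units.ext ?_)
      change (g : Matrix (ι ⊕ κ) (ι ⊕ κ) F) = h
      rw [← Matrix.fromBlocks_toBlocks (g : Matrix (ι ⊕ κ) (ι ⊕ κ) F),
        ← Matrix.fromBlocks_toBlocks (h : Matrix (ι ⊕ κ) (ι ⊕ κ) F), hg, hh, hgh.1.1, hgh.1.2,
        hgh.2]
    · rintro ⟨⟨⟨A, hA⟩, ⟨D, hD⟩⟩, B⟩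
      refine ⟨⟨(Matrix.isUnit_fromBlocks_zero₂₁ (B := B).2 ⟨hA, hD⟩).unit, ?_⟩, ?_⟩ <;> simp
  rw [e1, e2, Nat.card_prod, Nat.card_prod, card_subtype_isUnit, card_subtype_isUnit]
  congr 1
  rw [← Nat.card_congr (Matrix.of (m := ι) (n := κ) (α := F))]
  simp [Nat.card_fun, ← pow_mul, mul_comm]

theorem exists_linearEquiv_map_eq {V V' : Type} [AddCommGroup V] [Module F V]
    [FiniteDimensional F V] [AddCommGroup V'] [Module F V'] [FiniteDimensional F V']
    (hV : Module.finrank F V = Module.finrank F V') (W : Submodule F V) (W' : Submodule F V')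
    (hW : Module.finrank F W = Module.finrank F W') :
    ∃ f : V ≃ₗ[F] V', W.map (f : V →ₗ[F] V') = W' := by
  obtain ⟨U, hU⟩ := W.exists_isCompl
  obtain ⟨U', hU'⟩ := W'.exists_isCompl
  have h1 := Submodule.finrank_add_eq_of_isCompl hU
  have h2 := Submodule.finrank_add_eq_of_isCompl hU'
  let eW := LinearEquiv.ofFinrankEq W W' hW
  let eU := LinearEquiv.ofFinrankEq U U' (R := F) (by omega)
  let f := (Submodule.prodEquivOfIsCompl W U hU).symm.trans
    ((eW.prodCongr eU).trans (Submodule.prodEquivOfIsCompl W' U' hU'))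
  refine ⟨f, Submodule.eq_of_le_of_finrank_eq ?_ ((LinearEquiv.finrank_map_eq f W).trans hW)⟩
  rintro _ ⟨x, hx, rfl⟩
  have : f x = eW ⟨x, hx⟩ := by
    simp only [f, LinearEquiv.trans_apply]
    rw [show (Submodule.prodEquivOfIsCompl W U hU).symm x = (⟨x, hx⟩, 0) from
      Submodule.prodEquivOfIsCompl_symm_apply_left W U hU ⟨x, hx⟩]
    simp
  exact this ▸ (eW ⟨x, hx⟩).2

theorem finrank_range_inlCoord {F ι κ : Type} [Field F] [Fintype ι] :
    Module.finrank F (LinearMap.range (inlCoord F ι κ)) = Fintype.card ι := by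
  rw [LinearMap.finrank_range_of_inj inlCoord_injective, Module.finrank_fintype_fun_eq_card]

theorem card_linearEquiv_eq {μ ν : Type} [Fintype μ] [DecidableEq μ] [Fintype ν] [DecidableEq ν]
    (h : Fintype.card ν = Fintype.card μ) :
    Nat.card ((ν → F) ≃ₗ[F] (μ → F)) = Nat.card (GL μ F) := by
  let f : (ν → F) ≃ₗ[F] (μ → F) := LinearEquiv.funCongrLeft F F (Fintype.equivOfCardEq h).symm
  rw [Nat.card_congr (Matrix.GeneralLinearGroup.toLin.trans
      (LinearMap.GeneralLinearGroup.generalLinearEquiv F (μ → F))).toEquiv]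
  exact Nat.card_congr
    ⟨fun g => f.symm.trans g, fun g => f.trans g, fun g => by ext; simp, fun g => by ext; simp⟩

/-- Double counting of linear equivalences moving a coordinate subspace onto the cyclic one. -/
theorem card_finrank_mul_card_stabilizer {μ : Type} [Fintype μ] [DecidableEq μ]
    (w : FreeAlgebra F (Fin m)) (lam : F)
    (h : Fintype.card (ι ⊕ κ) = Fintype.card μ) :
    Nat.card {p : (μ → F) × (Fin m → Matrix μ μ F) // trace (FreeAlgebra.lift F p.2 w) = lam ∧
        Module.finrank F (cyclicSubspace p.1 p.2) = Fintype.card ι} *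
      Nat.card {f : (ι ⊕ κ → F) ≃ₗ[F] (ι ⊕ κ → F) //
        (LinearMap.range (inlCoord F ι κ)).map (f : (ι ⊕ κ → F) →ₗ[F] (ι ⊕ κ → F)) =
          LinearMap.range (inlCoord F ι κ)} =
    Nat.card (GL μ F) *
      Nat.card {p : (ι ⊕ κ → F) × (Fin m → Matrix (ι ⊕ κ) (ι ⊕ κ) F) //
        trace (FreeAlgebra.lift F p.2 w) = lam ∧
          cyclicSubspace p.1 p.2 = LinearMap.range (inlCoord F ι κ)} := by
  rw [← card_linearEquiv_eq h, ← Nat.card_prod, ← Nat.card_prod]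
  set W := LinearMap.range (inlCoord F ι κ) with hW
  have ex : ∀ p : {p : (μ → F) × (Fin m → Matrix μ μ F) //
      trace (FreeAlgebra.lift F p.2 w) = lam ∧
        Module.finrank F (cyclicSubspace p.1 p.2) = Fintype.card ι},
      ∃ f : (ι ⊕ κ → F) ≃ₗ[F] (μ → F),
        W.map (f : (ι ⊕ κ → F) →ₗ[F] (μ → F)) = cyclicSubspace p.1.1 p.1.2 := fun p =>
    exists_linearEquiv_map_eq (by simpa using h) _ _ (by rw [p.2.2, finrank_range_inlCoord])
  choose φ hφ using ex
  have hsymm : ∀ {V V' : Type} [AddCommGroup V] [Module F V] [AddCommGroup V'] [Module F V']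
      (f : V ≃ₗ[F] V') (A : Submodule F V) (B : Submodule F V'),
      A.map (f : V →ₗ[F] V') = B → B.map (f.symm : V' →ₗ[F] V) = A := by
    rintro V V' _ _ _ _ f A _ rfl
    rw [← Submodule.map_comp]
    simp
  have hcomp : ∀ {V V' V'' : Type} [AddCommGroup V] [Module F V] [AddCommGroup V'] [Module F V']
      [AddCommGroup V''] [Module F V'']
      (f : V ≃ₗ[F] V') (g : V' ≃ₗ[F] V'') (A : Submodule F V),
      A.map ((f.trans g : V ≃ₗ[F] V'') : V →ₗ[F] V'') =
        (A.map (f : V →ₗ[F] V')).map (g : V' →ₗ[F] V'') := by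
    intros
    rw [← Submodule.map_comp]
    rfl
  refine Nat.card_congr
    { toFun := fun x => (x.2.1.trans (φ x.1),
        ⟨transport (x.2.1.trans (φ x.1)).symm x.1.1, ?_, ?_⟩)
      invFun := fun y =>
        (⟨transport y.1 y.2.1, ?_, ?_⟩,
          ⟨y.1.trans (φ ⟨transport y.1 y.2.1, ?_, ?_⟩).symm, ?_⟩)
      left_inv := ?_
      right_inv := ?_ }
  · rw [trace_lift_transport, x.1.2.1]
  · rw [cyclicSubspace_transport]
    refine hsymm _ _ _ ?_
    rw [hcomp, x.2.2, hφ]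
  · rw [trace_lift_transport, y.2.2.1]
  · rw [cyclicSubspace_transport, LinearEquiv.finrank_map_eq, y.2.2.2, finrank_range_inlCoord]
  · rw [trace_lift_transport, y.2.2.1]
  · rw [cyclicSubspace_transport, LinearEquiv.finrank_map_eq, y.2.2.2, finrank_range_inlCoord]
  · rw [hcomp]
    refine hsymm _ _ _ ?_
    rw [hφ, cyclicSubspace_transport, y.2.2.2]
  · rintro ⟨⟨p, hp⟩, ⟨f, hf⟩⟩
    have h1 : transport (f.trans (φ ⟨p, hp⟩)) (transport (f.trans (φ ⟨p, hp⟩)).symm p) = p := by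
      rw [transport_transport, LinearEquiv.symm_trans_self, transport_refl]
    refine Prod.ext (Subtype.ext h1) (Subtype.ext ?_)
    simp only [h1]
    ext x : 1
    simp
  · rintro ⟨f, ⟨p, hp⟩⟩
    have h1 : ∀ g : (ι ⊕ κ → F) ≃ₗ[F] (μ → F), (f.trans g.symm).trans g = f := by
      intro g
      ext x : 1
      simp
    refine Prod.ext (h1 _) (Subtype.ext ?_)
    simp only [h1]
    rw [transport_transport, LinearEquiv.self_trans_symm, transport_refl]

theorem card_cyclicSubspace_eq_range_inlCoord [Fintype F] (w : FreeAlgebra F (Fin m)) (lam : F) :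
    Nat.card {p : (ι ⊕ κ → F) × (Fin m → Matrix (ι ⊕ κ) (ι ⊕ κ) F) //
        trace (FreeAlgebra.lift F p.2 w) = lam ∧
          cyclicSubspace p.1 p.2 = LinearMap.range (inlCoord F ι κ)} =
      Fintype.card F ^ (m * (Fintype.card ι * Fintype.card κ)) *
        ∑ a : F, Nat.card {p : (ι → F) × (Fin m → Matrix ι ι F) //
            trace (FreeAlgebra.lift F p.2 w) = a ∧ cyclicSubspace p.1 p.2 = ⊤} *
          Nat.card {D : Fin m → Matrix κ κ F // trace (FreeAlgebra.lift F D w) = lam - a} := by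
  have hB : Fintype.card F ^ (m * (Fintype.card ι * Fintype.card κ)) =
      Nat.card (Fin m → Matrix ι κ F) := by
    rw [Nat.card_fun, ← Nat.card_congr (Matrix.of (m := ι) (n := κ) (α := F)), Nat.card_fun,
      Nat.card_fun]
    simp only [Nat.card_eq_fintype_card, Fintype.card_fin, ← pow_mul]
    congr 1
    ring
  simp only [← Nat.card_prod]
  rw [← Nat.card_sigma, hB, ← Nat.card_prod]
  refine Nat.card_eq_of_bijective (fun x => (fun i => (x.1.2 i).toBlocks₁₂,
    ⟨trace (FreeAlgebra.lift F (fun i => (x.1.2 i).toBlocks₁₁) w),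
      ⟨(fun i => x.1.1 (Sum.inl i), fun i => (x.1.2 i).toBlocks₁₁), rfl,
        ((cyclicSubspace_eq_range_inlCoord_iff _ _).1 x.2.2).2.2⟩,
      ⟨fun i => (x.1.2 i).toBlocks₂₂, ?_⟩⟩)) ⟨?_, ?_⟩
  · have h := trace_lift_of_toBlocks_zero w
      ((cyclicSubspace_eq_range_inlCoord_iff _ _).1 x.2.2).2.1
    exact eq_sub_of_add_eq' (h.symm.trans x.2.1)
  · rintro ⟨⟨v, A⟩, hA⟩ ⟨⟨v', A'⟩, hA'⟩ h
    obtain ⟨hv, hz, -⟩ := (cyclicSubspace_eq_range_inlCoord_iff _ _).1 hA.2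
    obtain ⟨hv', hz', -⟩ := (cyclicSubspace_eq_range_inlCoord_iff _ _).1 hA'.2
    have h12 := congrArg Prod.fst h
    have h11 := congrArg (fun y => y.2.2.1.1) h
    have h22 := congrArg (fun y => y.2.2.2.1) h
    simp only [Prod.mk.injEq] at h11
    refine Subtype.ext (Prod.ext ?_ ?_)
    · ext (i | j)
      · exact congrFun h11.1 i
      · exact (hv j).trans (hv' j).symm
    · funext i
      change A i = A' i
      rw [← Matrix.fromBlocks_toBlocks (A i), ← Matrix.fromBlocks_toBlocks (A' i),
        show (A i).toBlocks₁₁ = _ from congrFun h11.2 i,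
        show (A i).toBlocks₁₂ = _ from congrFun h12 i,
        show (A i).toBlocks₂₂ = _ from congrFun h22 i,
        show (A i).toBlocks₂₁ = _ from hz i, show (A' i).toBlocks₂₁ = _ from hz' i]
  · rintro ⟨B, a, ⟨⟨v, A⟩, rfl, hA⟩, ⟨D, hD⟩⟩
    refine ⟨⟨(Sum.elim v 0, fun i => fromBlocks (A i) (B i) 0 (D i)), ?_, ?_⟩, ?_⟩
    · rw [trace_lift_of_toBlocks_zero w (fun i => by simp)]
      simp [hD]
    · rw [cyclicSubspace_eq_range_inlCoord_iff]
      simpa using hA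
    · rfl

/-- Convolving with a function that is constant away from zero. -/
theorem sum_mul_sub_zero_sub_one [Fintype F] (x y : F → ℚ)
    (hx : ∀ a, a ≠ 0 → x a = x 1) :
    ∑ a, x a * y (0 - a) - ∑ a, x a * y (1 - a) = (x 0 - x 1) * (y 0 - y 1) := by
  classical
  have hx' : ∀ a, x a = x 1 + if a = 0 then x 0 - x 1 else 0 := by
    intro a
    split_ifs with h
    · rw [h]; ring
    · rw [hx a h, add_zero]
  have h1 : ∀ c, ∑ a, x a * y (c - a) = x 1 * ∑ a, y a + (x 0 - x 1) * y c := by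
    intro c
    rw [← Equiv.sum_comp (Equiv.subLeft c) y, Finset.mul_sum]
    calc _ = ∑ a, (x 1 * y (c - a) + if a = 0 then (x 0 - x 1) * y (c - a) else 0) := by
          refine Finset.sum_congr rfl fun a _ => ?_
          rw [hx' a]
          split_ifs <;> ring
      _ = _ := by simp [Finset.sum_add_distrib]
  rw [h1, h1]
  ring

end

/-- Pairs with trace value `lam` whose cyclic subspace has dimension `k`. -/
noncomputable def rankCount (F : Type) [Field F] (m : ℕ) (w : FreeAlgebra F (Fin m))
    (n k : ℕ) (lam : F) : ℕ :=
  Nat.card {p : (Fin n → F) × (Fin m → Matrix (Fin n) (Fin n) F) //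
    trEval F m n w p.2 = lam ∧ Module.finrank F (genSubspace F m n p.1 p.2) = k}

theorem rankCount_zero {F : Type} [Field F] {m : ℕ} (w : FreeAlgebra F (Fin m)) (n : ℕ) (lam : F) :
    rankCount F m w n 0 lam = Ncount F m w n lam := by
  refine Nat.card_congr ⟨fun x => ⟨x.1.2, x.2.1⟩, fun A => ⟨(0, A.1), A.2, ?_⟩, ?_, ?_⟩
  · rw [Submodule.finrank_eq_zero]
    exact (cyclicSubspace_eq_bot_iff 0 A.1).2 rfl
  · rintro ⟨⟨v, A⟩, hA, hv⟩
    obtain rfl := (cyclicSubspace_eq_bot_iff v A).1 (Submodule.finrank_eq_zero.1 hv)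
    rfl
  · intro A
    rfl

theorem rankCount_self {F : Type} [Field F] {m : ℕ} (w : FreeAlgebra F (Fin m)) (n : ℕ) (lam : F) :
    rankCount F m w n n lam = Xcount F m w n lam := by
  refine Nat.card_congr (Equiv.subtypeEquivRight fun p => and_congr_right fun _ => ?_)
  constructor
  · intro h
    exact Submodule.eq_top_of_finrank_eq (by simpa using h)
  · intro h
    rw [h]
    simp

section
variable {F : Type} [Field F] [Fintype F] {m : ℕ} (w : FreeAlgebra F (Fin m))

theorem sum_rankCount (n : ℕ) (lam : F) :
    ∑ k ∈ Finset.range (n + 1), rankCount F m w n k lam =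
      Fintype.card F ^ n * Ncount F m w n lam := by
  have h : Fintype.card F ^ n = Nat.card (Fin n → F) := by simp
  rw [Finset.sum_range, h, Ncount, ← Nat.card_prod]
  simp only [rankCount]
  rw [← Nat.card_sigma]
  refine Nat.card_eq_of_bijective (fun x => (x.2.1.1, ⟨x.2.1.2, x.2.2.1⟩)) ⟨?_, ?_⟩
  · rintro ⟨k, ⟨⟨v, A⟩, hA, hk⟩⟩ ⟨k', ⟨⟨v', A'⟩, hA', hk'⟩⟩ h
    simp only [Prod.mk.injEq, Subtype.mk.injEq] at h
    obtain ⟨rfl, rfl⟩ := h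
    obtain rfl : k = k' := Fin.ext (hk.symm.trans hk')
    rfl
  · rintro ⟨v, ⟨A, hA⟩⟩
    have hle : Module.finrank F (genSubspace F m n v A) ≤ n :=
      (Submodule.finrank_le _).trans (by simp)
    exact ⟨⟨⟨_, Nat.lt_succ_of_le hle⟩, ⟨(v, A), hA, rfl⟩⟩, rfl⟩

theorem rankCount_mul (k l : ℕ) (lam : F) :
    rankCount F m w (k + l) k lam *
        (Nat.card (GL (Fin k) F) * Nat.card (GL (Fin l) F) * Fintype.card F ^ (k * l)) =
      Nat.card (GL (Fin (k + l)) F) * (Fintype.card F ^ (m * (k * l)) *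
        ∑ a : F, Xcount F m w k a * Ncount F m w l (lam - a)) := by
  have h := card_finrank_mul_card_stabilizer (ι := Fin k) (κ := Fin l) (μ := Fin (k + l)) w lam
    (by simp)
  rw [card_stabilizer_range_inlCoord, card_cyclicSubspace_eq_range_inlCoord] at h
  simp only [Fintype.card_fin, Nat.card_eq_fintype_card (α := F)] at h
  exact h

theorem rankCount_sub_div (hm : 1 ≤ m) {k l : ℕ}
    (hX : ∀ a : F, a ≠ 0 → Xcount F m w k a = Xcount F m w k 1) :
    ((rankCount F m w (k + l) k 0 : ℚ) - rankCount F m w (k + l) k 1) /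
        Nat.card (GL (Fin (k + l)) F) =
      (Fintype.card F : ℚ) ^ ((m - 1) * k * l) * (Bcount F m w k 0 - Bcount F m w k 1) *
        ((Ncount F m w l 0 : ℚ) - Ncount F m w l 1) / Nat.card (GL (Fin l) F) := by
  have hpos : ∀ d, (Nat.card (GL (Fin d) F) : ℚ) ≠ 0 := fun d =>
    Nat.cast_ne_zero.2 Nat.card_pos.ne'
  have hq : (Fintype.card F : ℚ) ≠ 0 := Nat.cast_ne_zero.2 Fintype.card_ne_zero
  have hconv := sum_mul_sub_zero_sub_one (fun a => (Xcount F m w k a : ℚ))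
    (fun a => (Ncount F m w l a : ℚ)) (fun a ha => by rw [hX a ha])
  have h0 := congrArg (Nat.cast (R := ℚ)) (rankCount_mul w k l (0 : F))
  have h1 := congrArg (Nat.cast (R := ℚ)) (rankCount_mul w k l (1 : F))
  have hexp : m * (k * l) = (m - 1) * k * l + k * l := by
    obtain ⟨m, rfl⟩ := Nat.exists_eq_add_of_le' hm
    simp only [Nat.add_sub_cancel]
    ring
  rw [hexp] at h0 h1
  push_cast at h0 h1
  rw [pow_add] at h0 h1
  have hqk : (Fintype.card F : ℚ) ^ (k * l) ≠ 0 := pow_ne_zero _ hq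
  simp only [Bcount]
  have hk := hpos k
  have hl := hpos l
  have hkl := hpos (k + l)
  generalize (Nat.card (GL (Fin k) F) : ℚ) = gk at *
  generalize (Nat.card (GL (Fin l) F) : ℚ) = gl at *
  generalize (Nat.card (GL (Fin (k + l)) F) : ℚ) = gn at *
  generalize (Fintype.card F : ℚ) ^ (k * l) = r at *
  field_simp
  apply mul_right_cancel₀ hqk
  linear_combination h0 - h1 + gn * (Fintype.card F : ℚ) ^ ((m - 1) * k * l) * r * hconv

end

/-- the inductive formula
`(q^n − 1)(N_n(0) − N_n(1))/#GL_n = (B_n(0) − B_n(1)) +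
   Σ_{k=1}^{n−1} q^{(m−1)k(n−k)} (B_k(0) − B_k(1))(N_{n−k}(0) − N_{n−k}(1))/#GL_{n−k}`,
under the assumption that the counts for nonzero values of `λ` agree. -/
theorem inductive_formula_for_counts
    (F : Type) [Field F] [Fintype F] (m : ℕ) (hm : 1 ≤ m)
    (w : FreeAlgebra F (Fin m)) (n : ℕ) (hn : 1 ≤ n)
    (hindep : ∀ d : ℕ, 1 ≤ d → d ≤ n → ∀ lam lam' : F, lam ≠ 0 → lam' ≠ 0 →
      Ncount F m w d lam = Ncount F m w d lam' ∧
      Xcount F m w d lam = Xcount F m w d lam') :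
    ((Fintype.card F : ℚ) ^ n - 1) *
        ((Ncount F m w n 0 : ℚ) - (Ncount F m w n 1 : ℚ)) /
        (Nat.card (GL (Fin n) F) : ℚ) =
      (Bcount F m w n 0 - Bcount F m w n 1) +
        ∑ k ∈ Finset.Ico 1 n,
          (Fintype.card F : ℚ) ^ ((m - 1) * k * (n - k)) *
            (Bcount F m w k 0 - Bcount F m w k 1) *
            ((Ncount F m w (n - k) 0 : ℚ) - (Ncount F m w (n - k) 1 : ℚ)) /
            (Nat.card (GL (Fin (n - k)) F) : ℚ) := by
  have hq : ∀ lam : F, (Fintype.card F : ℚ) ^ n * Ncount F m w n lam =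
      Ncount F m w n lam + ∑ k ∈ Finset.Ico 1 n, (rankCount F m w n k lam : ℚ) +
        Xcount F m w n lam := by
    intro lam
    have h := congrArg (Nat.cast (R := ℚ)) (sum_rankCount w n lam)
    rw [Finset.sum_range_succ, Finset.range_eq_Ico, Finset.sum_eq_sum_Ico_succ_bot hn,
      rankCount_zero, rankCount_self] at h
    push_cast at h
    exact h.symm
  have hsum : ∑ k ∈ Finset.Ico 1 n,
      (Fintype.card F : ℚ) ^ ((m - 1) * k * (n - k)) *
        (Bcount F m w k 0 - Bcount F m w k 1) *
        ((Ncount F m w (n - k) 0 : ℚ) - (Ncount F m w (n - k) 1 : ℚ)) /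
        (Nat.card (GL (Fin (n - k)) F) : ℚ) =
      ∑ k ∈ Finset.Ico 1 n, ((rankCount F m w n k 0 : ℚ) - rankCount F m w n k 1) /
        Nat.card (GL (Fin n) F) := by
    refine Finset.sum_congr rfl fun k hk => ?_
    obtain ⟨hk1, hkn⟩ := Finset.mem_Ico.1 hk
    have h := rankCount_sub_div w hm (k := k) (l := n - k)
      (fun a ha => (hindep k hk1 hkn.le a 1 ha one_ne_zero).2)
    rw [Nat.add_sub_cancel' hkn.le] at h
    exact h.symm
  rw [hsum, ← Finset.sum_div, Finset.sum_sub_distrib, Bcount, Bcount, ← sub_div, ← add_div]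
  congr 1
  linear_combination hq 0 - hq 1
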